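/- Let w ∈ ℝ^d with entries all equal on the index set {1,...,P}, let k₁,...,k_P be positive integers with D = k₁+...+k_P, let σ be smooth with bounded derivatives, and let x ~ N(0,I_d). Then for i ∈ {1,...,P}: E[(∏_{j=1}^P He_{k_j}(x_j))·σ'(⟨w,x⟩)·x_i] = (χ(w)/w_i)·(k_i·E_G[σ^{(D)}(‖w‖₂G)]) + w_i·χ(w)·E_G[σ^{(D+2)}(‖w‖₂G)], where χ(w) = ∏_{j=1}^P w_j^{k_j} and w_i ≠ 0. -/

import Mathlib

open MeasureTheory ProbabilityTheory Polynomial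

/-- The standard Gaussian measure `N(0, I_d)` on `ℝ^d`. -/
noncomputable def stdGaussian (d : ℕ) : Measure (Fin d → ℝ) :=
  Measure.pi fun _ => gaussianReal 0 1

namespace GaussianHermite

theorem derivative_hermite_succ (n : ℕ) :
    derivative (hermite (n + 1)) = ((n : ℤ[X]) + 1) * hermite n := by
  induction n with
  | zero => simp
  | succ n ih =>
    have h := hermite_succ n
    rw [hermite_succ (n + 1), derivative_sub, derivative_mul, derivative_X, ih, derivative_mul,
      h]
    simp only [derivative_add, derivative_natCast, derivative_one]
    push_cast
    ring

theorem mul_aeval_hermite_succ (n : ℕ) (x : ℝ) :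
    aeval x (hermite (n + 1)) * x =
      aeval x (hermite (n + 2)) + ((n + 1 : ℕ) : ℝ) * aeval x (hermite n) := by
  rw [hermite_succ (n + 1), derivative_hermite_succ]
  simp only [map_sub, map_mul, aeval_X, map_add, map_natCast, map_one]
  push_cast
  ring

theorem integrable_aeval_gaussianReal (p : ℤ[X]) :
    Integrable (fun x : ℝ => aeval x p) (gaussianReal 0 1) := by
  simp only [aeval_eq_sum_range, zsmul_eq_mul]
  refine integrable_finsetSum _ fun k _ => Integrable.const_mul ?_ _
  have h := (memLp_id_gaussianReal (μ := 0) (v := 1) k).integrable_norm_pow'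
  refine (integrable_norm_iff (by fun_prop)).1 ?_
  simpa using h

theorem hasDerivAt_gaussianPDFReal (x : ℝ) :
    HasDerivAt (gaussianPDFReal 0 1) (-x * gaussianPDFReal 0 1 x) x := by
  have h : HasDerivAt (fun y : ℝ => -(y - 0) ^ 2 / (2 * ((1 : NNReal) : ℝ))) (-x) x := by
    have h := (((hasDerivAt_id x).sub_const 0).fun_pow 2).fun_neg.div_const (2 * ((1 : NNReal) : ℝ))
    exact h.congr_deriv (by simp; ring)
  have := h.exp.const_mul (√(2 * Real.pi * ((1 : NNReal) : ℝ)))⁻¹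
  rw [gaussianPDFReal_def]
  exact this.congr_deriv (by ring)

theorem integrable_gaussianReal_iff {f : ℝ → ℝ} :
    Integrable f (gaussianReal 0 1) ↔ Integrable fun x => gaussianPDFReal 0 1 x * f x := by
  rw [gaussianReal_of_var_ne_zero 0 one_ne_zero,
    integrable_withDensity_iff_integrable_smul' (measurable_gaussianPDF 0 1)
      (ae_of_all _ fun _ => gaussianPDF_lt_top)]
  simp

theorem integrable_aeval_mul {H : ℝ → ℝ} {K : ℝ} (p : ℤ[X]) (hH : Continuous H)
    (hK : ∀ x, |H x| ≤ K) : Integrable (fun x : ℝ => aeval x p * H x) (gaussianReal 0 1) :=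
  (integrable_aeval_gaussianReal p).mul_bdd hH.aestronglyMeasurable (ae_of_all _ hK)

theorem integral_hermite_succ_mul {H H' : ℝ → ℝ} {K K' : ℝ} (n : ℕ)
    (hH : ∀ x, HasDerivAt H (H' x) x) (hH' : Continuous H') (hK : ∀ x, |H x| ≤ K)
    (hK' : ∀ x, |H' x| ≤ K') :
    ∫ x, aeval x (hermite (n + 1)) * H x ∂(gaussianReal 0 1) =
      ∫ x, aeval x (hermite n) * H' x ∂(gaussianReal 0 1) := by
  have hHc : Continuous H := continuous_iff_continuousAt.2 fun x => (hH x).continuousAt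
  have hu : ∀ x : ℝ, HasDerivAt (fun x => gaussianPDFReal 0 1 x * aeval x (hermite n))
      (-(gaussianPDFReal 0 1 x * aeval x (hermite (n + 1)))) x := by
    intro x
    refine ((hasDerivAt_gaussianPDFReal x).fun_mul
      ((hermite n).hasDerivAt_aeval x)).congr_deriv ?_
    rw [hermite_succ]
    simp only [map_sub, map_mul, aeval_X]
    ring
  have key := integral_mul_deriv_eq_deriv_mul_of_integrable
    (fun x _ => hu x) (fun x _ => hH x)
    (by simpa [Pi.mul_def, mul_assoc] using
      integrable_gaussianReal_iff.1 (integrable_aeval_mul (hermite n) hH' hK'))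
    (by simpa only [Pi.mul_def, Pi.neg_def, neg_mul, mul_assoc] using
      (integrable_gaussianReal_iff.1 (integrable_aeval_mul (hermite (n + 1)) hHc hK)).neg)
    (by simpa [Pi.mul_def, mul_assoc] using
      integrable_gaussianReal_iff.1 (integrable_aeval_mul (hermite n) hHc hK))
  rw [integral_gaussianReal_eq_integral_smul one_ne_zero,
    integral_gaussianReal_eq_integral_smul one_ne_zero]
  simp only [neg_mul, integral_neg, neg_neg, mul_assoc] at key
  simpa only [smul_eq_mul] using key.symm

theorem hasDerivAt_iteratedDeriv {F : ℝ → ℝ} (hF : ContDiff ℝ (⊤ : ℕ∞) F) (n : ℕ) (x : ℝ) :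
    HasDerivAt (iteratedDeriv n F) (iteratedDeriv (n + 1) F x) x := by
  rw [iteratedDeriv_succ]
  exact (hF.differentiable_iteratedDeriv n (by exact_mod_cast WithTop.coe_lt_top n)
    |>.differentiableAt).hasDerivAt

theorem continuous_iteratedDeriv {F : ℝ → ℝ} (hF : ContDiff ℝ (⊤ : ℕ∞) F) (n : ℕ) :
    Continuous (iteratedDeriv n F) :=
  continuous_iff_continuousAt.2 fun x => (hasDerivAt_iteratedDeriv hF n x).continuousAt

theorem integral_hermite_mul_comp {F : ℝ → ℝ} {K : ℝ} (hF : ContDiff ℝ (⊤ : ℕ∞) F)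
    (hK : ∀ n x, |iteratedDeriv n F x| ≤ K) (a c : ℝ) (n m : ℕ) :
    ∫ x, aeval x (hermite n) * iteratedDeriv m F (a * x + c) ∂(gaussianReal 0 1) =
      a ^ n * ∫ x, iteratedDeriv (m + n) F (a * x + c) ∂(gaussianReal 0 1) := by
  induction n generalizing m with
  | zero => simp
  | succ n ih =>
    have hd : ∀ x, HasDerivAt (fun x => iteratedDeriv m F (a * x + c))
        (a * iteratedDeriv (m + 1) F (a * x + c)) x := by
      intro x
      have h := (hasDerivAt_iteratedDeriv hF m (a * x + c)).comp x
        (((hasDerivAt_id x).const_mul a).add_const c)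
      exact h.congr_deriv (by simp [mul_comm])
    have hc := continuous_iteratedDeriv hF (m + 1)
    rw [integral_hermite_succ_mul (K' := |a| * K) n hd (by fun_prop) (fun x => hK m _)
      (fun x => by rw [abs_mul]; gcongr; exact hK _ _)]
    simp only [mul_left_comm _ a]
    rw [integral_const_mul, ih, pow_succ, show m + 1 + n = m + (n + 1) by ring]
    ring

theorem integrable_prod_hermite_mul {ι : Type*} [Fintype ι] {H : (ι → ℝ) → ℝ} {K : ℝ}
    (v : ι → ℕ) (hH : Continuous H) (hK : ∀ x, |H x| ≤ K) :
    Integrable (fun x : ι → ℝ => (∏ l, aeval (x l) (hermite (v l))) * H x)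
      (Measure.pi fun _ => gaussianReal 0 1) :=
  (Integrable.fintype_prod (f := fun l (y : ℝ) => aeval y (hermite (v l)))
    fun _ => integrable_aeval_gaussianReal _).mul_bdd hH.aestronglyMeasurable (ae_of_all _ hK)

theorem integral_prod_hermite_mul_comp {F : ℝ → ℝ} {K : ℝ} (hF : ContDiff ℝ (⊤ : ℕ∞) F)
    (hK : ∀ n x, |iteratedDeriv n F x| ≤ K) (d : ℕ) (v : Fin d → ℕ) (w : Fin d → ℝ) (c : ℝ)
    (m : ℕ) :
    ∫ x, (∏ l, aeval (x l) (hermite (v l))) * iteratedDeriv m F (∑ l, w l * x l + c)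
        ∂(Measure.pi fun _ => gaussianReal 0 1) =
      (∏ l, w l ^ v l) * ∫ x, iteratedDeriv (m + ∑ l, v l) F (∑ l, w l * x l + c)
        ∂(Measure.pi fun _ => gaussianReal 0 1) := by
  induction d generalizing c m with
  | zero => simp
  | succ d ih =>
    have hmp := (measurePreserving_piFinSuccAbove
      (fun _ : Fin (d + 1) => gaussianReal 0 1) 0).symm
    have split : ∀ (v : Fin (d + 1) → ℕ) (m : ℕ),
        Integrable (fun z : ℝ × (Fin d → ℝ) =>
          (aeval z.1 (hermite (v 0)) * ∏ l, aeval (z.2 l) (hermite (v (Fin.succ l)))) *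
            iteratedDeriv m F (w 0 * z.1 + ∑ l, w (Fin.succ l) * z.2 l + c))
          ((gaussianReal 0 1).prod (Measure.pi fun _ => gaussianReal 0 1)) ∧
        ∫ x, (∏ l, aeval (x l) (hermite (v l))) * iteratedDeriv m F (∑ l, w l * x l + c)
          ∂(Measure.pi fun _ => gaussianReal 0 1) =
        ∫ z : ℝ × (Fin d → ℝ),
          (aeval z.1 (hermite (v 0)) * ∏ l, aeval (z.2 l) (hermite (v (Fin.succ l)))) *
            iteratedDeriv m F (w 0 * z.1 + ∑ l, w (Fin.succ l) * z.2 l + c)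
          ∂((gaussianReal 0 1).prod (Measure.pi fun _ => gaussianReal 0 1)) := by
      intro v m
      have hc := continuous_iteratedDeriv hF m
      have hint := integrable_prod_hermite_mul v
        (H := fun x => iteratedDeriv m F (∑ l, w l * x l + c)) (by fun_prop) (fun x => hK m _)
      have h1 := hmp.integrable_comp_of_integrable hint
      have h2 := hmp.integral_comp' (g := fun x : Fin (d + 1) → ℝ =>
        (∏ l, aeval (x l) (hermite (v l))) * iteratedDeriv m F (∑ l, w l * x l + c))
      simp only [Function.comp_def, MeasurableEquiv.piFinSuccAbove_symm_apply,
        Fin.insertNthEquiv_apply, Fin.insertNth_zero, Fin.prod_univ_succ, Fin.sum_univ_succ,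
        Fin.cons_zero, Fin.cons_succ] at h1 h2
      refine ⟨h1, ?_⟩
      simp only [Fin.prod_univ_succ, Fin.sum_univ_succ]
      exact h2.symm
    obtain ⟨hi, he⟩ := split v m
    obtain ⟨hi', he'⟩ := split (Fin.cons 0 (fun l => v l.succ)) (m + v 0)
    obtain ⟨hi'', he''⟩ := split 0 (m + ∑ l, v l)
    simp only [Fin.cons_zero, Fin.cons_succ, Pi.zero_apply, hermite_zero, map_one, one_mul,
      Finset.prod_const_one] at hi' he' hi'' he''
    rw [he, he'', integral_prod_symm _ hi, integral_prod _ hi'']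
    have inner : ∀ y : Fin d → ℝ, ∫ x : ℝ,
        (aeval x (hermite (v 0)) * ∏ l, aeval (y l) (hermite (v (Fin.succ l)))) *
            iteratedDeriv m F (w 0 * x + ∑ l, w (Fin.succ l) * y l + c) ∂(gaussianReal 0 1) =
        w 0 ^ v 0 * ∫ x : ℝ, (∏ l, aeval (y l) (hermite (v (Fin.succ l)))) *
            iteratedDeriv (m + v 0) F (w 0 * x + ∑ l, w (Fin.succ l) * y l + c)
              ∂(gaussianReal 0 1) := by
      intro y
      have h := integral_hermite_mul_comp hF hK (w 0) (∑ l, w (Fin.succ l) * y l + c) (v 0) m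
      simp only [← add_assoc] at h
      rw [integral_const_mul, mul_left_comm, ← h, ← integral_const_mul]
      congr 1 with x
      ring
    have outer : ∀ x : ℝ, ∫ y : Fin d → ℝ, (∏ l, aeval (y l) (hermite (v (Fin.succ l)))) *
            iteratedDeriv (m + v 0) F (w 0 * x + ∑ l, w (Fin.succ l) * y l + c)
              ∂(Measure.pi fun _ => gaussianReal 0 1) =
        (∏ l : Fin d, w l.succ ^ v l.succ) * ∫ y : Fin d → ℝ,
            iteratedDeriv (m + ∑ l, v l) F (w 0 * x + ∑ l, w (Fin.succ l) * y l + c)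
              ∂(Measure.pi fun _ => gaussianReal 0 1) := by
      intro x
      have h := ih (fun l => v l.succ) (fun l => w l.succ) (w 0 * x + c) (m + v 0)
      have e : ∀ y : Fin d → ℝ, w 0 * x + ∑ l, w (Fin.succ l) * y l + c =
        ∑ l, w (Fin.succ l) * y l + (w 0 * x + c) := fun y => by ring
      simp only [e, Fin.sum_univ_succ v, ← add_assoc m]
      exact h
    simp only [inner]
    rw [integral_const_mul, ← integral_prod_symm _ hi', integral_prod _ hi']
    simp only [outer]
    rw [integral_const_mul, Fin.prod_univ_succ, mul_assoc]

theorem map_sum_mul_pi_gaussianReal {ι : Type*} [Fintype ι] (w : ι → ℝ) :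
    (Measure.pi fun _ : ι => gaussianReal 0 1).map (fun x => ∑ l, w l * x l) =
      (gaussianReal 0 1).map (fun g => √(∑ l, w l ^ 2) * g) := by
  have hw : Measurable fun x : ι → ℝ => ∑ l, w l * x l := by fun_prop
  have : IsProbabilityMeasure
      ((Measure.pi fun _ : ι => gaussianReal 0 1).map (fun x => ∑ l, w l * x l)) :=
    Measure.isProbabilityMeasure_map hw.aemeasurable
  rw [gaussianReal_map_const_mul]
  apply Measure.ext_of_charFun
  ext t
  rw [charFun_gaussianReal, charFun_apply_real, integral_map hw.aemeasurable
    (Measurable.aestronglyMeasurable (by fun_prop))]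
  have h : ∀ x : ι → ℝ, Complex.exp (t * (∑ l, w l * x l : ℝ) * Complex.I) =
      ∏ l, Complex.exp ((t * w l : ℝ) * (x l : ℝ) * Complex.I) := by
    intro x
    rw [← Complex.exp_sum]
    push_cast
    rw [Finset.mul_sum, Finset.sum_mul]
    simp only [mul_assoc]
  simp only [h]
  rw [integral_fintype_prod_eq_prod
    (f := fun l (y : ℝ) => Complex.exp ((t * w l : ℝ) * (y : ℝ) * Complex.I))]
  simp only [← charFun_apply_real, charFun_gaussianReal, ← Complex.exp_sum]
  have hs : √(∑ l, w l ^ 2) ^ 2 = ∑ l, w l ^ 2 :=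
    Real.sq_sqrt (Finset.sum_nonneg fun _ _ => sq_nonneg _)
  simp only [NNReal.coe_mul, NNReal.coe_mk, hs]
  congr 1
  push_cast
  simp [Finset.sum_div, Finset.mul_sum, mul_pow, mul_comm]

theorem integral_prod_hermite_mul_comp_inner {F : ℝ → ℝ} {K : ℝ} (hF : ContDiff ℝ (⊤ : ℕ∞) F)
    (hK : ∀ n x, |iteratedDeriv n F x| ≤ K) {d : ℕ} (v : Fin d → ℕ) (w : Fin d → ℝ) (m : ℕ) :
    ∫ x, (∏ l, aeval (x l) (hermite (v l))) * iteratedDeriv m F (∑ l, w l * x l)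
        ∂(Measure.pi fun _ => gaussianReal 0 1) =
      (∏ l, w l ^ v l) * ∫ g, iteratedDeriv (m + ∑ l, v l) F (√(∑ l, w l ^ 2) * g)
        ∂(gaussianReal 0 1) := by
  have h := integral_prod_hermite_mul_comp hF hK d v w 0 m
  simp only [add_zero] at h
  have hc := continuous_iteratedDeriv hF (m + ∑ l, v l)
  have hw : Measurable fun x : Fin d → ℝ => ∑ l, w l * x l := by fun_prop
  rw [h, ← integral_map (φ := fun g => √(∑ l, w l ^ 2) * g) (by fun_prop)
      hc.aestronglyMeasurable, ← map_sum_mul_pi_gaussianReal,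
    integral_map hw.aemeasurable hc.aestronglyMeasurable]

end GaussianHermite

open GaussianHermite

/-- population-gradient formula. For `x ~ N(0,I_d)`, a vector `w` whose first `P`
entries are all equal, exponents `k₁,…,k_P ≥ 1` with `D = k₁+⋯+k_P`, and `i ∈ [P]`:
`E[(∏_j He_{k_j}(x_j)) σ'(⟨w,x⟩) x_i]
  = (χ(w)/w_i)(k_i E_G[σ^{(D)}(‖w‖G)]) + w_i χ(w) E_G[σ^{(D+2)}(‖w‖G)]`,
where `χ(w) = ∏_j w_j^{k_j}`. -/
theorem stmt_6 (d P : ℕ) (hP : 0 < P) (hPd : P ≤ d) (w : Fin d → ℝ)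
    (heq : ∀ i j : Fin P, w (Fin.castLE hPd i) = w (Fin.castLE hPd j))
    (kk : Fin P → ℕ) (hkk : ∀ j, 0 < kk j) (D : ℕ) (hD : D = ∑ j, kk j)
    (σ : ℝ → ℝ) (hσ : ContDiff ℝ (⊤ : ℕ∞) σ) (K : ℝ)
    (hbd : ∀ n : ℕ, ∀ x : ℝ, |iteratedDeriv n σ x| ≤ K)
    (i : Fin P) (hwi : w (Fin.castLE hPd i) ≠ 0) :
    ∫ x, (∏ j : Fin P, aeval (x (Fin.castLE hPd j)) (hermite (kk j))) *
          deriv σ (∑ l, w l * x l) * x (Fin.castLE hPd i) ∂(stdGaussian d)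
      = (∏ j : Fin P, w (Fin.castLE hPd j) ^ kk j) / w (Fin.castLE hPd i) *
          ((kk i : ℝ) *
            ∫ g, iteratedDeriv D σ (Real.sqrt (∑ l, w l ^ 2) * g) ∂(gaussianReal 0 1))
        + w (Fin.castLE hPd i) * (∏ j : Fin P, w (Fin.castLE hPd j) ^ kk j) *
            ∫ g, iteratedDeriv (D + 2) σ (Real.sqrt (∑ l, w l ^ 2) * g) ∂(gaussianReal 0 1) := by
  classical
  set e : Fin P → Fin d := Fin.castLE hPd
  have hinj : Function.Injective e := Fin.castLE_injective hPd
  have hv : ∀ k : Fin P → ℕ, ∀ j, Function.extend e k (0 : Fin d → ℕ) (e j) = k j :=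
    fun k j => hinj.extend_apply k 0 j
  have hv0 : ∀ k : Fin P → ℕ, ∀ l ∉ Set.range e, Function.extend e k (0 : Fin d → ℕ) l = 0 :=
    fun k l hl => Function.extend_apply' (f := e) k (0 : Fin d → ℕ) l (fun ⟨j, hj⟩ => hl ⟨j, hj⟩)
  have hprod : ∀ (k : Fin P → ℕ) (x : Fin d → ℝ),
      ∏ l, aeval (x l) (hermite (Function.extend e k 0 l)) =
        ∏ j, aeval (x (e j)) (hermite (k j)) := fun k x =>
    (Fintype.prod_of_injective e hinj _ _ (fun l hl => by simp [hv0 k l hl])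
      (fun j => by rw [hv])).symm
  have hpow : ∀ k : Fin P → ℕ, ∏ l, w l ^ Function.extend e k 0 l = ∏ j, w (e j) ^ k j :=
    fun k => (Fintype.prod_of_injective e hinj _ _ (fun l hl => by simp [hv0 k l hl])
      (fun j => by rw [hv])).symm
  have hsum : ∀ k : Fin P → ℕ, ∑ l, Function.extend e k 0 l = ∑ j, k j :=
    fun k => (Fintype.sum_of_injective e hinj _ _ (fun l hl => hv0 k l hl)
      (fun j => by rw [hv])).symm
  have formula : ∀ k : Fin P → ℕ, ∫ x : Fin d → ℝ, (∏ j, aeval (x (e j)) (hermite (k j))) *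
        iteratedDeriv 1 σ (∑ l, w l * x l) ∂(Measure.pi fun _ => gaussianReal 0 1) =
      (∏ j, w (e j) ^ k j) * ∫ g, iteratedDeriv (1 + ∑ j, k j) σ (√(∑ l, w l ^ 2) * g)
        ∂(gaussianReal 0 1) := by
    intro k
    have h := integral_prod_hermite_mul_comp_inner hσ hbd (Function.extend e k 0) w 1
    simpa only [hprod, hpow, hsum] using h
  have integ : ∀ k : Fin P → ℕ, Integrable (fun x : Fin d → ℝ =>
      (∏ j, aeval (x (e j)) (hermite (k j))) * iteratedDeriv 1 σ (∑ l, w l * x l))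
      (Measure.pi fun _ => gaussianReal 0 1) := by
    intro k
    have hc := continuous_iteratedDeriv hσ 1
    have h := integrable_prod_hermite_mul (Function.extend e k 0)
      (H := fun x => iteratedDeriv 1 σ (∑ l, w l * x l)) (by fun_prop) (fun x => hbd 1 _)
    simpa only [hprod] using h
  obtain ⟨n, hn⟩ : ∃ n, kk i = n + 1 := Nat.exists_eq_succ_of_ne_zero (hkk i).ne'
  set up := Function.update kk i (n + 2)
  set dn := Function.update kk i n
  have hup_ne : ∀ j ∈ Finset.univ.erase i, up j = kk j := fun j hj =>
    Function.update_of_ne (Finset.ne_of_mem_erase hj) _ _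
  have hdn_ne : ∀ j ∈ Finset.univ.erase i, dn j = kk j := fun j hj =>
    Function.update_of_ne (Finset.ne_of_mem_erase hj) _ _
  have hupi : up i = n + 2 := Function.update_self ..
  have hdni : dn i = n := Function.update_self ..
  have prod_up : ∀ f : Fin P → ℕ → ℝ,
      ∏ j, f j (up j) = f i (n + 2) * ∏ j ∈ Finset.univ.erase i, f j (kk j) := fun f => by
    rw [← Finset.mul_prod_erase _ _ (Finset.mem_univ i), hupi,
      Finset.prod_congr rfl fun j hj => by rw [hup_ne j hj]]
  have prod_dn : ∀ f : Fin P → ℕ → ℝ,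
      ∏ j, f j (dn j) = f i n * ∏ j ∈ Finset.univ.erase i, f j (kk j) := fun f => by
    rw [← Finset.mul_prod_erase _ _ (Finset.mem_univ i), hdni,
      Finset.prod_congr rfl fun j hj => by rw [hdn_ne j hj]]
  have prod_kk : ∀ f : Fin P → ℕ → ℝ,
      ∏ j, f j (kk j) = f i (n + 1) * ∏ j ∈ Finset.univ.erase i, f j (kk j) := fun f => by
    rw [← Finset.mul_prod_erase _ _ (Finset.mem_univ i), hn]
  have sum_kk : ∑ j, kk j = n + 1 + ∑ j ∈ Finset.univ.erase i, kk j := by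
    rw [← Finset.add_sum_erase _ _ (Finset.mem_univ i), hn]
  have sum_up : 1 + ∑ j, up j = D + 2 := by
    rw [hD, sum_kk, ← Finset.add_sum_erase _ _ (Finset.mem_univ i), hupi,
      Finset.sum_congr rfl hup_ne]
    ring
  have sum_dn : 1 + ∑ j, dn j = D := by
    rw [hD, sum_kk, ← Finset.add_sum_erase _ _ (Finset.mem_univ i), hdni,
      Finset.sum_congr rfl hdn_ne]
    ring
  have pointwise : ∀ x : Fin d → ℝ,
      (∏ j, aeval (x (e j)) (hermite (kk j))) * deriv σ (∑ l, w l * x l) * x (e i) =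
      (∏ j, aeval (x (e j)) (hermite (up j))) * iteratedDeriv 1 σ (∑ l, w l * x l) +
        (kk i : ℝ) *
          ((∏ j, aeval (x (e j)) (hermite (dn j))) * iteratedDeriv 1 σ (∑ l, w l * x l)) := by
    intro x
    have h := mul_aeval_hermite_succ n (x (e i))
    rw [prod_up fun j k => aeval (x (e j)) (hermite k),
      prod_dn fun j k => aeval (x (e j)) (hermite k),
      prod_kk fun j k => aeval (x (e j)) (hermite k), iteratedDeriv_one, hn]
    linear_combination (∏ j ∈ Finset.univ.erase i, aeval (x (e j)) (hermite (kk j))) *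
      deriv σ (∑ l, w l * x l) * h
  rw [_root_.stdGaussian]
  simp only [pointwise]
  rw [integral_add (integ up) ((integ dn).const_mul _), integral_const_mul, formula, formula,
    sum_up, sum_dn, prod_up fun j k => w (e j) ^ k, prod_dn fun j k => w (e j) ^ k,
    prod_kk fun j k => w (e j) ^ k]
  field_simp
  ring
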